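/- arXiv:2507.14723 — 2 statements merged into one kernel-verified Lean document; each statement's English description precedes it below -/
import Mathlib

section
/- (One-round progress of Dispersed-To-k-Dispersed.) Let ι be a finite type, k a natural number, and g, g' : ι → ℕ such that (i) g(i) ≤ g'(i) + 1 for every i, (ii) whenever g'(i) < g(i) one has g(i) > k, and (iii) there exists i with g(i) < k and g'(i) > g(i). Then ∑_i min(g'(i), k) > ∑_i min(g(i), k). -/
theorem one_round_progress {ι : Type*} [Fintype ι] (k : ℕ) (g g' : ι → ℕ)
    (h1 : ∀ i, g i ≤ g' i + 1)
    (h2 : ∀ i, g' i < g i → k < g i)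
    (h3 : ∃ i, g i < k ∧ g i < g' i) :
    ∑ i, min (g i) k < ∑ i, min (g' i) k := by
  obtain ⟨j, hjk, hj⟩ := h3
  refine Finset.sum_lt_sum (fun i _ => ?_) ⟨j, Finset.mem_univ j, by omega⟩
  have := h1 i
  have := h2 i
  omega
end

section
/- (Abstract O(lk)-round termination of Dispersed-To-k-Dispersed.) Let ι be a finite type with |ι| = l, let k be a natural number, and let g : ℕ → ι → ℕ be a sequence of gap profiles such that for every round t and every i: (i) g(t, i) ≤ g(t+1, i) + 1; (ii) if g(t+1, i) < g(t, i) then g(t, i) > k; and (iii) if there exists j with g(t, j) < k, then there exists i with g(t, i) < k and g(t+1, i) > g(t, i). Then there exists a round t ≤ l·k such that g(t, i) ≥ k for every i. -/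
theorem dispersed_to_k_dispersed_terminates {ι : Type*} [Fintype ι] (l k : ℕ)
    (hcard : Fintype.card ι = l) (g : ℕ → ι → ℕ)
    (h1 : ∀ t i, g t i ≤ g (t + 1) i + 1)
    (h2 : ∀ t i, g (t + 1) i < g t i → k < g t i)
    (h3 : ∀ t, (∃ j, g t j < k) → ∃ i, g t i < k ∧ g t i < g (t + 1) i) :
    ∃ t ≤ l * k, ∀ i, k ≤ g t i := by
  by_contra! hbad
  -- The sum of the gaps truncated at `k` strictly increases, yet never exceeds `l * k`.
  have sum_ge : ∀ t ≤ l * k + 1, t ≤ ∑ i, min (g t i) k := by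
    intro t
    induction t with
    | zero => simp
    | succ t ih =>
      intro ht
      obtain ⟨i, hik, hi⟩ := h3 t (hbad t (by omega))
      have hlt : ∑ i, min (g t i) k < ∑ i, min (g (t + 1) i) k := by
        refine Finset.sum_lt_sum (fun j _ => ?_) ⟨i, Finset.mem_univ i, by omega⟩
        have := h1 t j
        have := h2 t j
        omega
      have := ih (by omega)
      omega
  have sum_le : ∑ i, min (g (l * k + 1) i) k ≤ l * k := by
    simpa [hcard] using
      Finset.sum_le_card_nsmul Finset.univ (fun i => min (g (l * k + 1) i) k) k
        (fun i _ => min_le_right _ _)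
  have := sum_ge (l * k + 1) le_rfl
  omega
end
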